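/- Let G be a finite simple graph with maximum degree at most 3, let S be a set of vertices of G admitting a vertically extensible partial drawing, and let v be a vertex not in S having at most two neighbors in S and at most one neighbor outside S. Then there exists a vertically extensible partial drawing of S ∪ {v}. -/

import Mathlib

open InnerProductGeometry

noncomputable section

/-- Points of three-dimensional Euclidean space. -/
abbrev Pt : Type := EuclideanSpace ℝ (Fin 3)

/-- The image of a polyline given by a list of points: the union of the closed
segments between consecutive points. -/
def polyImage (l : List Pt) : Set Pt :=
  ⋃ q ∈ l.zip l.tail, segment ℝ q.1 q.2

/-- A polyline is simple (its image is a simple arc): consecutive points are distinct,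
two consecutive segments meet exactly in their shared endpoint, and two
non-consecutive segments are disjoint. -/
def SimplePolyline (l : List Pt) : Prop :=
  l.Chain' (· ≠ ·) ∧
  ∀ i j : ℕ, ∀ hi : i + 1 < l.length, ∀ hj : j + 1 < l.length, i < j →
    segment ℝ (l.get ⟨i, by omega⟩) (l.get ⟨i + 1, hi⟩) ∩
      segment ℝ (l.get ⟨j, by omega⟩) (l.get ⟨j + 1, hj⟩) =
      if j = i + 1 then {l.get ⟨j, by omega⟩} else ∅

/-- A polyline drawing of a (finite simple) graph `G` in ℝ³: an injective placement
`p` of the vertices, and for each (oriented) edge `uv` a list of points, starting at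
`p u` and ending at `p v`, giving the polygonal path of the edge; the path of `vu`
is the reverse of the path of `uv`.  The interior points of the list are the bends
of the edge. -/
structure PolylineDrawing {V : Type*} (G : SimpleGraph V) where
  p : V → Pt
  p_inj : Function.Injective p
  seq : ∀ u v : V, G.Adj u v → List Pt
  seq_head : ∀ u v h, (seq u v h).head? = some (p u)
  seq_last : ∀ u v h, (seq u v h).getLast? = some (p v)
  seq_symm : ∀ u v h, seq v u h.symm = (seq u v h).reverse

variable {V : Type*} {G : SimpleGraph V}

/-- Every edge is drawn with at most `k` bends, i.e. its point list has at most
`k + 2` points. -/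
def MaxBends (D : PolylineDrawing G) (k : ℕ) : Prop :=
  ∀ u v h, (D.seq u v h).length ≤ k + 2

/-- The image of the whole drawing: all vertex points and all edge paths. -/
def drawingImage (D : PolylineDrawing G) : Set Pt :=
  Set.range D.p ∪ ⋃ (u) (v) (h : G.Adj u v), polyImage (D.seq u v h)

/-- The drawing has angular resolution at least `θ`: the angle at every bend of every
edge, and the angle at a common vertex between the initial segments of any two
distinct edges, is at least `θ`. -/
def AngularResAtLeast (D : PolylineDrawing G) (θ : ℝ) : Prop :=
  (∀ u v h, ∀ a q b : Pt, [a, q, b] <:+: D.seq u v h →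
    θ ≤ angle (a - q) (b - q)) ∧
  (∀ v u w : V, ∀ hu : G.Adj v u, ∀ hw : G.Adj v w, u ≠ w →
    ∀ a b : Pt, (D.seq v u hu)[1]? = some a → (D.seq v w hw)[1]? = some b →
      θ ≤ angle (a - D.p v) (b - D.p v))

/-- The drawing is non-crossing: every edge path is a simple arc meeting the vertex
points only in its endpoints, and the paths of two distinct edges intersect exactly
in the images of their common endpoints. -/
def NonCrossing (D : PolylineDrawing G) : Prop :=
  (∀ u v h, SimplePolyline (D.seq u v h)) ∧
  (∀ u v h, polyImage (D.seq u v h) ∩ Set.range D.p = {D.p u, D.p v}) ∧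
  (∀ u v u' v' : V, ∀ h : G.Adj u v, ∀ h' : G.Adj u' v', s(u, v) ≠ s(u', v') →
    polyImage (D.seq u v h) ∩ polyImage (D.seq u' v' h') =
      D.p '' (({u, v} : Set V) ∩ {u', v'}))

/-- The unit vector in the positive `z`-direction. -/
def zDir : Pt := EuclideanSpace.single 2 1

/-- The open ray from `q` in the positive `z`-direction. -/
def zRay (q : Pt) : Set Pt := {x : Pt | ∃ t : ℝ, 0 < t ∧ x = q + t • zDir}

/-- `D` is a vertically extensible partial drawing of the vertex set `S` of `G`:
a non-crossing drawing of the induced subgraph `G[S]` with angular resolution at least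
`2π/3` and at most two bends per edge, such that every vertex of `S` has at most one
neighbor outside `S`; for every `v ∈ S` with a neighbor outside `S`, placing that
neighbor anywhere on the open ray from `p v` in the positive `z`-direction and joining
it to `p v` by a straight segment stays disjoint from the rest of the drawing
(`ray_clear`) and makes angles at least `2π/3` with the initial segments of the edges
at `v` (`ray_angle`), so that for every choice of the point the extended drawing of
`G[S ∪ {w}]` is non-crossing with angular resolution at least `2π/3` and no bends on
`vw`; and no three extension rays are coplanar. -/
structure IsVertExtensible {V : Type*} (G : SimpleGraph V) (S : Set V)
    (D : PolylineDrawing (G.induce S)) : Prop where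
  noncross : NonCrossing D
  bends : MaxBends D 2
  res : AngularResAtLeast D (2 * Real.pi / 3)
  out_unique : ∀ v : S, ∀ w w' : V, w ∉ S → w' ∉ S →
    G.Adj (v : V) w → G.Adj (v : V) w' → w = w'
  ray_clear : ∀ v : S, (∃ w, w ∉ S ∧ G.Adj (v : V) w) →
    zRay (D.p v) ∩ drawingImage D = ∅
  ray_angle : ∀ v : S, (∃ w, w ∉ S ∧ G.Adj (v : V) w) →
    ∀ u : S, ∀ h : (G.induce S).Adj v u, ∀ a : Pt, (D.seq v u h)[1]? = some a →
      2 * Real.pi / 3 ≤ angle zDir (a - D.p v)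
  rays_noncoplanar : ∀ v₁ v₂ v₃ : S,
    (∃ w, w ∉ S ∧ G.Adj (v₁ : V) w) → (∃ w, w ∉ S ∧ G.Adj (v₂ : V) w) →
    (∃ w, w ∉ S ∧ G.Adj (v₃ : V) w) →
    v₁ ≠ v₂ → v₁ ≠ v₃ → v₂ ≠ v₃ →
    ¬ Coplanar ℝ (zRay (D.p v₁) ∪ zRay (D.p v₂) ∪ zRay (D.p v₃))

section Geometry

/-- The orientation determinant of the horizontal projections of three points. -/
def planarDet (a b c : Pt) : ℝ :=
  (b 0 - a 0) * (c 1 - a 1) - (b 1 - a 1) * (c 0 - a 0)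

@[simp] lemma zDir_zero : zDir 0 = 0 := by simp [zDir]

@[simp] lemma zDir_one : zDir 1 = 0 := by simp [zDir]

@[simp] lemma zDir_two : zDir 2 = 1 := by simp [zDir]

lemma pt_ext {x y : Pt} (h0 : x 0 = y 0) (h1 : x 1 = y 1) (h2 : x 2 = y 2) : x = y := by
  ext i
  fin_cases i <;> assumption

lemma mem_zRay_iff {q x : Pt} : x ∈ zRay q ↔ x 0 = q 0 ∧ x 1 = q 1 ∧ q 2 < x 2 := by
  constructor
  · rintro ⟨t, ht, rfl⟩
    simp [ht]
  · rintro ⟨h0, h1, h2⟩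
    refine ⟨x 2 - q 2, sub_pos.2 h2, pt_ext ?_ ?_ ?_⟩ <;> simp [h0, h1]

lemma coplanar_zRays_of_planarDet_eq_zero {a b c : Pt} (h : planarDet a b c = 0) :
    Coplanar ℝ (zRay a ∪ zRay b ∪ zRay c) := by
  obtain ⟨w, hb, hc⟩ : ∃ w : Pt,
      (∃ r s : ℝ, b = a + r • zDir + s • w) ∧ ∃ r s : ℝ, c = a + r • zDir + s • w := by
    simp only [planarDet] at h
    by_cases h0 : b 0 - a 0 = 0
    · by_cases h1 : b 1 - a 1 = 0
      · refine ⟨c - a, ⟨b 2 - a 2, 0, pt_ext ?_ ?_ ?_⟩, ⟨0, 1, by simp⟩⟩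
        · simp; linarith
        · simp; linarith
        · simp
      · have h2 : c 0 - a 0 = 0 := by
          rw [h0] at h
          have : (b 1 - a 1) * (c 0 - a 0) = 0 := by linarith
          exact (mul_eq_zero.1 this).resolve_left h1
        refine ⟨b - a, ⟨0, 1, by simp⟩, ⟨c 2 - a 2 - (c 1 - a 1) / (b 1 - a 1) * (b 2 - a 2),
          (c 1 - a 1) / (b 1 - a 1), pt_ext ?_ ?_ ?_⟩⟩
        · simp [h0]; linarith
        · simp; field_simp; ring
        · simp; ring
    · refine ⟨b - a, ⟨0, 1, by simp⟩, ⟨c 2 - a 2 - (c 0 - a 0) / (b 0 - a 0) * (b 2 - a 2),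
          (c 0 - a 0) / (b 0 - a 0), pt_ext ?_ ?_ ?_⟩⟩
      · simp; field_simp; ring
      · simp; field_simp; linarith
      · simp; ring
  have key : ∀ x ∈ zRay a ∪ zRay b ∪ zRay c, x - a ∈ Submodule.span ℝ ({zDir, w} : Set Pt) := by
    intro x hx
    rw [Submodule.mem_span_pair]
    obtain ⟨r, s, rfl⟩ := hb
    obtain ⟨r', s', rfl⟩ := hc
    rcases hx with (⟨t, -, rfl⟩ | ⟨t, -, rfl⟩) | ⟨t, -, rfl⟩
    · exact ⟨t, 0, by module⟩
    · exact ⟨r + t, s, by module⟩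
    · exact ⟨r' + t, s', by module⟩
  have hle : vectorSpan ℝ (zRay a ∪ zRay b ∪ zRay c) ≤
      Submodule.span ℝ ({zDir, w} : Set Pt) := by
    rw [vectorSpan_def, Submodule.span_le]
    rintro _ ⟨x, hx, y, hy, rfl⟩
    have := Submodule.sub_mem _ (key x hx) (key y hy)
    simpa using this
  rw [coplanar_iff_finrank_le_two]
  refine (Submodule.finrank_mono hle).trans ?_
  refine (finrank_span_le_card _).trans ?_
  simpa using Finset.card_le_two (a := zDir) (b := w)

lemma planarDet_eq_zero_of_coplanar_zRays {a b c : Pt}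
    (h : Coplanar ℝ (zRay a ∪ zRay b ∪ zRay c)) : planarDet a b c = 0 := by
  by_contra hd
  set W := vectorSpan ℝ (zRay a ∪ zRay b ∪ zRay c)
  have hmem : ∀ q : Pt, ∀ t : ℝ, 0 < t → q + t • zDir ∈ zRay q := fun q t ht => ⟨t, ht, rfl⟩
  have ha := hmem a 1 one_pos
  have hz : zDir ∈ W := by
    have := vsub_mem_vectorSpan ℝ (s := zRay a ∪ zRay b ∪ zRay c)
      (Or.inl (Or.inl (hmem a 2 two_pos))) (Or.inl (Or.inl ha))
    convert this using 1
    simp only [vsub_eq_sub]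
    module
  have hb : b - a ∈ W := by
    have := vsub_mem_vectorSpan ℝ (s := zRay a ∪ zRay b ∪ zRay c)
      (Or.inl (Or.inr (hmem b 1 one_pos))) (Or.inl (Or.inl ha))
    simpa using this
  have hc : c - a ∈ W := by
    have := vsub_mem_vectorSpan ℝ (s := zRay a ∪ zRay b ∪ zRay c)
      (Or.inr (hmem c 1 one_pos)) (Or.inl (Or.inl ha))
    simpa using this
  have hli : LinearIndependent ℝ ![zDir, b - a, c - a] := by
    rw [Fintype.linearIndependent_iff]
    intro g hg
    simp only [Fin.sum_univ_three, Matrix.cons_val_zero, Matrix.cons_val_one,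
      Matrix.cons_val_two] at hg
    have e0 := congrArg (fun x : Pt => x 0) hg
    have e1 := congrArg (fun x : Pt => x 1) hg
    have e2 := congrArg (fun x : Pt => x 2) hg
    simp at e0 e1 e2
    unfold planarDet at hd
    have g1 : g 1 = 0 := by
      have : g 1 * ((b 0 - a 0) * (c 1 - a 1) - (b 1 - a 1) * (c 0 - a 0)) = 0 := by
        linear_combination (c 1 - a 1) * e0 - (c 0 - a 0) * e1
      exact (mul_eq_zero.1 this).resolve_right hd
    have g2 : g 2 = 0 := by
      have : g 2 * ((b 0 - a 0) * (c 1 - a 1) - (b 1 - a 1) * (c 0 - a 0)) = 0 := by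
        linear_combination (b 0 - a 0) * e1 - (b 1 - a 1) * e0
      exact (mul_eq_zero.1 this).resolve_right hd
    have g0 : g 0 = 0 := by rw [g1, g2] at e2; linarith
    intro i
    fin_cases i <;> assumption
  have hsub : Submodule.span ℝ (Set.range ![zDir, b - a, c - a]) ≤ W := by
    rw [Submodule.span_le]
    rintro _ ⟨i, rfl⟩
    fin_cases i
    exacts [hz, hb, hc]
  have h3 := finrank_span_eq_card hli
  have h4 := Submodule.finrank_mono hsub
  have h5 := coplanar_iff_finrank_le_two.1 h
  rw [h3, Fintype.card_fin] at h4
  exact absurd (h4.trans h5) (by norm_num)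

lemma two_pi_div_three_le_angle {x y : Pt} {r s : ℝ} (hr : 0 < r) (hs : 0 < s)
    (hx : x 0 ^ 2 + x 1 ^ 2 + x 2 ^ 2 = r ^ 2) (hy : y 0 ^ 2 + y 1 ^ 2 + y 2 ^ 2 = s ^ 2)
    (h : 2 * (x 0 * y 0 + x 1 * y 1 + x 2 * y 2) ≤ -(r * s)) :
    2 * Real.pi / 3 ≤ angle x y := by
  have nx : ‖x‖ = r := by
    rw [EuclideanSpace.norm_eq, Fin.sum_univ_three]
    simp only [Real.norm_eq_abs, sq_abs]
    rw [hx, Real.sqrt_sq hr.le]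
  have ny : ‖y‖ = s := by
    rw [EuclideanSpace.norm_eq, Fin.sum_univ_three]
    simp only [Real.norm_eq_abs, sq_abs]
    rw [hy, Real.sqrt_sq hs.le]
  have hi : inner ℝ x y = x 0 * y 0 + x 1 * y 1 + x 2 * y 2 := by
    simp [PiLp.inner_apply, Fin.sum_univ_three]
    ring
  have h3 : 2 * Real.pi / 3 = Real.arccos (-(1 / 2)) := by
    rw [Real.arccos_neg, ← Real.cos_pi_div_three, Real.arccos_cos] <;>
      linarith [Real.pi_pos]
  rw [h3, angle, hi, nx, ny]
  apply Real.arccos_le_arccos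
  rw [div_le_iff₀ (by positivity)]
  linarith

lemma lt_of_angle_zDir {x : Pt} (h : 2 * Real.pi / 3 ≤ angle zDir x) : x 2 < 0 := by
  by_contra! hx
  have : angle zDir x ≤ Real.pi / 2 := by
    rw [angle, Real.arccos_le_pi_div_two]
    have : inner ℝ zDir x = x 2 := by simp [PiLp.inner_apply, Fin.sum_univ_three]
    rw [this]
    positivity
  linarith [Real.pi_pos]

lemma mem_segment_coords {a b x : Pt} (h : x ∈ segment ℝ a b) :
    ∃ t : ℝ, 0 ≤ t ∧ t ≤ 1 ∧ ∀ i, x i = a i + t * (b i - a i) := by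
  rw [segment_eq_image'] at h
  obtain ⟨t, ⟨h0, h1⟩, rfl⟩ := h
  exact ⟨t, h0, h1, fun i => by simp⟩

/-- Two segments from `q` enclosing a nonzero angle meet only in `q`. -/
lemma eq_of_mem_segments_of_angle {q a b x : Pt} (h : 2 * Real.pi / 3 ≤ angle (a - q) (b - q))
    (ha : x ∈ segment ℝ q a) (hb : x ∈ segment ℝ q b) : x = q := by
  by_contra hne
  rw [segment_eq_image'] at ha hb
  obtain ⟨s, ⟨hs0, -⟩, rfl⟩ := ha
  obtain ⟨t, ⟨ht0, -⟩, ht⟩ := hb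
  have hs : 0 < s := hs0.lt_of_ne fun h => hne (by simp [← h])
  have ht' : 0 < t := ht0.lt_of_ne fun h => hne (by rw [← ht]; simp [← h])
  have e : t • (b - q) = s • (a - q) := by simpa using ht
  have hq : a - q ≠ 0 := fun h => hne (by simp [h])
  rw [← angle_smul_right_of_pos _ _ ht', e, angle_smul_right_of_pos _ _ hs, angle_self hq] at h
  linarith [Real.pi_pos]

lemma angle_bend (q m p : Pt) {t : ℝ} (ht : 0 < t) (hm : m = p + t • zDir) :
    angle (q - m) (p - m) = angle zDir (m - q) := by
  have : p - m = t • -zDir := by rw [hm]; module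
  rw [this, angle_smul_right_of_pos _ _ ht, ← neg_sub m q, angle_neg_neg, angle_comm]

end Geometry

section Polylines

lemma polyImage_triple (a b c : Pt) :
    polyImage [a, b, c] = segment ℝ a b ∪ segment ℝ b c := by
  simp [polyImage]

lemma polyImage_triple_symm (a b c : Pt) : polyImage [a, b, c] = polyImage [c, b, a] := by
  rw [polyImage_triple, polyImage_triple, Set.union_comm, segment_symm ℝ b c,
    segment_symm ℝ a b]

lemma simplePolyline_triple {a b c : Pt} (hab : a ≠ b) (hbc : b ≠ c)
    (h : ∀ x ∈ segment ℝ a b, x ∈ segment ℝ b c → x = b) : SimplePolyline [a, b, c] := by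
  have hchain : List.IsChain (· ≠ ·) [a, b, c] := by simp [hab, hbc]
  refine ⟨hchain, ?_⟩
  intro i j hi hj hij
  have hi' : i = 0 := by simp at hj; omega
  have hj' : j = 1 := by simp at hj; omega
  subst hi' hj'
  simp only [List.get_eq_getElem]
  ext x
  simp only [Set.mem_inter_iff]
  constructor
  · rintro ⟨h1, h2⟩
    simpa using h x h1 h2
  · intro hx
    have : x = b := by simpa using hx
    subst this
    exact ⟨right_mem_segment ℝ _ _, left_mem_segment ℝ _ _⟩

lemma isBounded_polyImage (l : List Pt) : Bornology.IsBounded (polyImage l) := by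
  refine (Bornology.isBounded_biUnion (s := {q | q ∈ l.zip l.tail}) (List.finite_toSet _)).2 ?_
  intro q _
  rw [← convexHull_pair]
  exact isBounded_convexHull.2 (Set.toFinite _).isBounded

lemma isBounded_drawingImage [Finite V] (D : PolylineDrawing G) :
    Bornology.IsBounded (drawingImage D) := by
  refine (Set.finite_range _).isBounded.union ?_
  refine Bornology.isBounded_iUnion.2 fun u => Bornology.isBounded_iUnion.2 fun v => ?_
  by_cases h : G.Adj u v
  · simpa [h] using isBounded_polyImage (D.seq u v h)
  · simp [h]

lemma exists_height_bound [Finite V] (D : PolylineDrawing G) :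
    ∃ H : ℝ, ∀ x ∈ drawingImage D, x 2 < H := by
  obtain ⟨R, hR⟩ := (isBounded_drawingImage D).exists_norm_le
  refine ⟨R + 1, fun x hx => ?_⟩
  have h1 : x 2 ≤ ‖x‖ := (le_abs_self _).trans (PiLp.norm_apply_le x 2)
  linarith [hR x hx]

lemma p_mem_drawingImage (D : PolylineDrawing G) (u : V) : D.p u ∈ drawingImage D :=
  Or.inl ⟨u, rfl⟩

lemma polyImage_subset_drawingImage (D : PolylineDrawing G) {u v : V} (h : G.Adj u v) :
    polyImage (D.seq u v h) ⊆ drawingImage D :=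
  fun _ hx => Or.inr (Set.mem_iUnion.2 ⟨u, Set.mem_iUnion.2 ⟨v, Set.mem_iUnion.2 ⟨h, hx⟩⟩⟩)

/-- Distinct edges meet exactly in the images of their common endpoints as soon as they meet
in vertex points only. -/
lemma nonCrossing_of_inter_subset (D : PolylineDrawing G)
    (hsimple : ∀ u v h, SimplePolyline (D.seq u v h))
    (hends : ∀ u v h, polyImage (D.seq u v h) ∩ Set.range D.p = {D.p u, D.p v})
    (hinter : ∀ u v u' v' : V, ∀ h : G.Adj u v, ∀ h' : G.Adj u' v', s(u, v) ≠ s(u', v') →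
      polyImage (D.seq u v h) ∩ polyImage (D.seq u' v' h') ⊆ Set.range D.p) :
    NonCrossing D := by
  have mem_iff : ∀ u v h w, D.p w ∈ polyImage (D.seq u v h) ↔ w ∈ ({u, v} : Set V) := by
    intro u v h w
    have := Set.ext_iff.1 (hends u v h) (D.p w)
    simpa [D.p_inj.eq_iff] using this
  refine ⟨hsimple, hends, fun u v u' v' h h' hne => ?_⟩
  ext x
  constructor
  · intro hx
    obtain ⟨w, rfl⟩ := hinter u v u' v' h h' hne hx
    exact ⟨w, ⟨(mem_iff _ _ _ _).1 hx.1, (mem_iff _ _ _ _).1 hx.2⟩, rfl⟩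
  · rintro ⟨w, ⟨h1, h2⟩, rfl⟩
    exact ⟨(mem_iff _ _ _ _).2 h1, (mem_iff _ _ _ _).2 h2⟩

end Polylines

section Extension

variable {S : Set V}

/-- A vertex of `S` with a neighbor outside `S`. -/
def HasRay (G : SimpleGraph V) (S : Set V) (x : S) : Prop :=
  ∃ w, w ∉ S ∧ G.Adj (x : V) w

open Classical in
/-- The drawing obtained from a drawing of `G[S]` by placing a new vertex `v` at `Q` and joining
it to each neighbor `u ∈ S` by an edge with the single bend `M u`. -/
def PolylineDrawing.addApex (D : PolylineDrawing (G.induce S)) (v : V) (Q : Pt) (M : S → Pt)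
    (hQ : Q ∉ Set.range D.p) : PolylineDrawing (G.induce (insert v S)) where
  p x := if h : (x : V) ∈ S then D.p ⟨x, h⟩ else Q
  p_inj := by
    rintro ⟨x, hx⟩ ⟨y, hy⟩ h
    by_cases hxS : x ∈ S <;> by_cases hyS : y ∈ S <;> simp only [hxS, hyS, dite_true,
      dite_false] at h
    · simpa using D.p_inj h
    · exact absurd ⟨_, h⟩ hQ
    · exact absurd ⟨_, h.symm⟩ hQ
    · have e := (hx.resolve_right hxS).trans (hy.resolve_right hyS).symm
      simpa using e
  seq x y h :=
    if hx : (x : V) ∈ S then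
      if hy : (y : V) ∈ S then D.seq ⟨x, hx⟩ ⟨y, hy⟩ h
      else [D.p ⟨x, hx⟩, M ⟨x, hx⟩, Q]
    else
      if hy : (y : V) ∈ S then [Q, M ⟨y, hy⟩, D.p ⟨y, hy⟩] else [Q]
  seq_head x y h := by
    by_cases hx : (x : V) ∈ S <;> by_cases hy : (y : V) ∈ S <;> simp only [hx, hy, dite_true, dite_false, List.head?_cons]
    exact D.seq_head ⟨x, hx⟩ ⟨y, hy⟩ h
  seq_last x y h := by
    by_cases hx : (x : V) ∈ S <;> by_cases hy : (y : V) ∈ S <;> simp [hx, hy]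
    exact D.seq_last ⟨x, hx⟩ ⟨y, hy⟩ h
  seq_symm x y h := by
    by_cases hx : (x : V) ∈ S <;> by_cases hy : (y : V) ∈ S <;> simp [hx, hy]
    exact D.seq_symm ⟨x, hx⟩ ⟨y, hy⟩ h

/-- The inclusion of `S` into `insert v S`. -/
def oldVertex (v : V) (x : S) : ↥(insert v S) := ⟨x, Or.inr x.2⟩

/-- The vertex `v` of `insert v S`. -/
def newVertex (v : V) (S : Set V) : ↥(insert v S) := ⟨v, Or.inl rfl⟩

lemma eq_newVertex_or_oldVertex (v : V) (x : ↥(insert v S)) :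
    x = newVertex v S ∨ ∃ y : S, x = oldVertex v y := by
  obtain ⟨x, rfl | hx⟩ := x
  · exact Or.inl rfl
  · exact Or.inr ⟨⟨x, hx⟩, rfl⟩

section AddApex

variable {D : PolylineDrawing (G.induce S)} {v : V} {Q : Pt} {M : S → Pt}
  {hQ : Q ∉ Set.range D.p}

lemma addApex_p_old (x : S) : (D.addApex v Q M hQ).p (oldVertex v x) = D.p x := by
  simp [PolylineDrawing.addApex, oldVertex]

lemma addApex_p_new (hv : v ∉ S) : (D.addApex v Q M hQ).p (newVertex v S) = Q := by
  simp [PolylineDrawing.addApex, newVertex, hv]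

lemma addApex_seq_old (x y : S) (h) :
    (D.addApex v Q M hQ).seq (oldVertex v x) (oldVertex v y) h = D.seq x y h := by
  simp [PolylineDrawing.addApex, oldVertex]

lemma addApex_seq_new_old (hv : v ∉ S) (y : S) (h) :
    (D.addApex v Q M hQ).seq (newVertex v S) (oldVertex v y) h = [Q, M y, D.p y] := by
  simp [PolylineDrawing.addApex, oldVertex, newVertex, hv]

lemma addApex_seq_old_new (hv : v ∉ S) (y : S) (h) :
    (D.addApex v Q M hQ).seq (oldVertex v y) (newVertex v S) h = [D.p y, M y, Q] := by
  simp [PolylineDrawing.addApex, oldVertex, newVertex, hv]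

lemma addApex_edge_cases (hv : v ∉ S) (x y : ↥(insert v S))
    (h : (G.induce (insert v S)).Adj x y) :
    (∃ (a b : S) (h' : (G.induce S).Adj a b), x = oldVertex v a ∧ y = oldVertex v b ∧
      (D.addApex v Q M hQ).seq x y h = D.seq a b h') ∨
    (∃ a : S, G.Adj v a ∧ x = newVertex v S ∧ y = oldVertex v a ∧
      (D.addApex v Q M hQ).seq x y h = [Q, M a, D.p a]) ∨
    (∃ a : S, G.Adj v a ∧ x = oldVertex v a ∧ y = newVertex v S ∧
      (D.addApex v Q M hQ).seq x y h = [D.p a, M a, Q]) := by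
  rcases eq_newVertex_or_oldVertex v x with rfl | ⟨a, rfl⟩ <;>
    rcases eq_newVertex_or_oldVertex v y with rfl | ⟨b, rfl⟩
  · exact absurd rfl h.ne
  · exact Or.inr (Or.inl ⟨b, h, rfl, rfl, addApex_seq_new_old hv b h⟩)
  · exact Or.inr (Or.inr ⟨a, G.adj_symm h, rfl, rfl, addApex_seq_old_new hv a h⟩)
  · exact Or.inl ⟨a, b, h, rfl, rfl, addApex_seq_old a b h⟩

lemma addApex_edge_image (hv : v ∉ S) (x y : ↥(insert v S))
    (h : (G.induce (insert v S)).Adj x y) :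
    (∃ (a b : S) (h' : (G.induce S).Adj a b), s(x, y) = s(oldVertex v a, oldVertex v b) ∧
      polyImage ((D.addApex v Q M hQ).seq x y h) = polyImage (D.seq a b h')) ∨
    (∃ a : S, G.Adj v a ∧ s(x, y) = s(newVertex v S, oldVertex v a) ∧
      polyImage ((D.addApex v Q M hQ).seq x y h) = polyImage [Q, M a, D.p a]) := by
  rcases addApex_edge_cases (D := D) (Q := Q) (M := M) (hQ := hQ) hv x y h with
    ⟨a, b, h', rfl, rfl, e⟩ | ⟨a, ha, rfl, rfl, e⟩ | ⟨a, ha, rfl, rfl, e⟩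
  · exact Or.inl ⟨a, b, h', rfl, by rw [e]⟩
  · exact Or.inr ⟨a, ha, rfl, by rw [e]⟩
  · exact Or.inr ⟨a, ha, Sym2.eq_swap, by rw [e, polyImage_triple_symm]⟩

lemma addApex_drawingImage (hv : v ∉ S) {x : Pt}
    (hx : x ∈ drawingImage (D.addApex v Q M hQ)) :
    x ∈ drawingImage D ∨ x = Q ∨ ∃ a : S, G.Adj v a ∧ x ∈ polyImage [Q, M a, D.p a] := by
  rcases hx with ⟨w, rfl⟩ | hx
  · rcases eq_newVertex_or_oldVertex v w with rfl | ⟨a, rfl⟩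
    · exact Or.inr (Or.inl (addApex_p_new hv))
    · rw [addApex_p_old]
      exact Or.inl (p_mem_drawingImage D a)
  · simp only [Set.mem_iUnion] at hx
    obtain ⟨u, w, h, hx⟩ := hx
    rcases addApex_edge_image (D := D) (Q := Q) (M := M) (hQ := hQ) hv u w h with
      ⟨a, b, h', -, e⟩ | ⟨a, ha, -, e⟩ <;> rw [e] at hx
    · exact Or.inl (polyImage_subset_drawingImage D h' hx)
    · exact Or.inr (Or.inr ⟨a, ha, hx⟩)

end AddApex

lemma IsVertExtensible.notMem_zRay {D : PolylineDrawing (G.induce S)}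
    (hD : IsVertExtensible G S D) {x : S} (hx : HasRay G S x) {q : Pt}
    (hq : q ∈ drawingImage D) : q ∉ zRay (D.p x) := fun h =>
  (Set.ext_iff.1 (hD.ray_clear x hx) q).1 ⟨h, hq⟩

/-- Distinct extension rays lie on distinct vertical lines. -/
lemma IsVertExtensible.eq_of_horizontal_eq {D : PolylineDrawing (G.induce S)}
    (hD : IsVertExtensible G S D) {x y : S} (hx : HasRay G S x) (hy : HasRay G S y)
    (h0 : D.p x 0 = D.p y 0) (h1 : D.p x 1 = D.p y 1) : x = y := by
  rcases lt_trichotomy (D.p x 2) (D.p y 2) with h | h | h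
  · exact absurd (mem_zRay_iff.2 ⟨h0.symm, h1.symm, h⟩)
      (hD.notMem_zRay hx (p_mem_drawingImage D y))
  · exact D.p_inj (pt_ext h0 h1 h)
  · exact absurd (mem_zRay_iff.2 ⟨h0, h1, h⟩) (hD.notMem_zRay hy (p_mem_drawingImage D x))

lemma IsVertExtensible.planarDet_ne_zero {D : PolylineDrawing (G.induce S)}
    (hD : IsVertExtensible G S D) {x y z : S} (hx : HasRay G S x) (hy : HasRay G S y)
    (hz : HasRay G S z) (hxy : x ≠ y) (hxz : x ≠ z) (hyz : y ≠ z) :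
    planarDet (D.p x) (D.p y) (D.p z) ≠ 0 := fun h =>
  hD.rays_noncoplanar x y z hx hy hz hxy hxz hyz (coplanar_zRays_of_planarDet_eq_zero h)

/-- The new vertex and the bends of its edges lie above the drawing, in a position where adding
them keeps the drawing vertically extensible. -/
structure IsHighApex (D : PolylineDrawing (G.induce S)) (v : V) (Q : Pt) (M : S → Pt)
    (H : ℝ) : Prop where
  below : ∀ x ∈ drawingImage D, x 2 < H
  apex_high : H < Q 2
  bend_high : ∀ u : S, G.Adj v u → H < M u 2
  bend_mem_zRay : ∀ u : S, G.Adj v u → M u ∈ zRay (D.p u)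
  slope : ∀ u : S, G.Adj v u → 2 * Real.pi / 3 ≤ angle zDir (M u - Q)
  fork : ∀ u u' : S, G.Adj v u → G.Adj v u' → u ≠ u' →
    2 * Real.pi / 3 ≤ angle (M u - Q) (M u' - Q)
  edge_off_rays : ∀ u : S, G.Adj v u → ∀ x : S, HasRay G S x → x ≠ u →
    ∀ q ∈ segment ℝ Q (M u), q ∉ zRay (D.p x)
  apex_off_rays : ∀ x : S, HasRay G S x → ¬ G.Adj v x → Q ∉ zRay (D.p x)
  generic : ∀ x y : S, HasRay G S x → HasRay G S y → ¬ G.Adj v x → ¬ G.Adj v y → x ≠ y →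
    planarDet Q (D.p x) (D.p y) ≠ 0

namespace IsHighApex

variable {D : PolylineDrawing (G.induce S)} {v : V} {Q : Pt} {M : S → Pt} {H : ℝ}

lemma notMem_range (hA : IsHighApex D v Q M H) : Q ∉ Set.range D.p := by
  rintro ⟨x, rfl⟩
  exact (hA.below _ (p_mem_drawingImage D x)).not_gt hA.apex_high

lemma bend_lt_apex (hA : IsHighApex D v Q M H) {u : S} (hu : G.Adj v u) : M u 2 < Q 2 := by
  simpa using lt_of_angle_zDir (hA.slope u hu)

lemma upper_segment (hA : IsHighApex D v Q M H) {u : S} (hu : G.Adj v u) {x : Pt}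
    (hx : x ∈ segment ℝ Q (M u)) : M u 2 ≤ x 2 ∧ x 2 ≤ Q 2 := by
  obtain ⟨t, h0, h1, ht⟩ := mem_segment_coords hx
  rw [ht 2]
  constructor <;> nlinarith [hA.bend_lt_apex hu]

lemma lower_segment (hA : IsHighApex D v Q M H) {u : S} (hu : G.Adj v u) {x : Pt}
    (hx : x ∈ segment ℝ (M u) (D.p u)) :
    x 0 = D.p u 0 ∧ x 1 = D.p u 1 ∧ D.p u 2 ≤ x 2 ∧ x 2 ≤ M u 2 := by
  obtain ⟨t, h0, h1, ht⟩ := mem_segment_coords hx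
  obtain ⟨m0, m1, m2⟩ := mem_zRay_iff.1 (hA.bend_mem_zRay u hu)
  rw [ht 0, ht 1, ht 2, m0, m1]
  refine ⟨by ring, by ring, ?_, ?_⟩ <;> nlinarith

lemma edge_cases (hA : IsHighApex D v Q M H) {u : S} (hu : G.Adj v u) {x : Pt}
    (hx : x ∈ polyImage [Q, M u, D.p u]) :
    (x ∈ segment ℝ Q (M u) ∧ H < x 2) ∨ x ∈ zRay (D.p u) ∨ x = D.p u := by
  rw [polyImage_triple] at hx
  rcases hx with hx | hx
  · exact Or.inl ⟨hx, (hA.bend_high u hu).trans_le (hA.upper_segment hu hx).1⟩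
  · obtain ⟨h0, h1, h2, -⟩ := hA.lower_segment hu hx
    rcases h2.lt_or_eq with h2 | h2
    · exact Or.inr (Or.inl (mem_zRay_iff.2 ⟨h0, h1, h2⟩))
    · exact Or.inr (Or.inr (pt_ext h0 h1 h2.symm))

lemma edge_inter_image (hA : IsHighApex D v Q M H) (hD : IsVertExtensible G S D) (hv : v ∉ S)
    {u : S} (hu : G.Adj v u) {x : Pt} (hx : x ∈ polyImage [Q, M u, D.p u])
    (hx' : x ∈ drawingImage D) : x = D.p u := by
  rcases hA.edge_cases hu hx with ⟨-, h⟩ | h | h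
  · exact absurd (hA.below x hx') h.not_gt
  · exact absurd h (hD.notMem_zRay ⟨v, hv, hu.symm⟩ hx')
  · exact h

lemma edge_off_zRay (hA : IsHighApex D v Q M H) (hD : IsVertExtensible G S D) (hv : v ∉ S)
    {u : S} (hu : G.Adj v u) {y : S} (hy : HasRay G S y) (hyu : y ≠ u) {x : Pt}
    (hx : x ∈ polyImage [Q, M u, D.p u]) : x ∉ zRay (D.p y) := by
  rcases hA.edge_cases hu hx with ⟨h, -⟩ | h | rfl
  · exact hA.edge_off_rays u hu y hy hyu x h
  · intro h'
    obtain ⟨h0, h1, -⟩ := mem_zRay_iff.1 h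
    obtain ⟨h0', h1', -⟩ := mem_zRay_iff.1 h'
    exact hyu (hD.eq_of_horizontal_eq hy ⟨v, hv, hu.symm⟩ (h0'.symm.trans h0)
      (h1'.symm.trans h1))
  · exact hD.notMem_zRay hy (p_mem_drawingImage D u)

lemma edge_inter_edge (hA : IsHighApex D v Q M H) (hD : IsVertExtensible G S D) (hv : v ∉ S)
    {u u' : S} (hu : G.Adj v u) (hu' : G.Adj v u') (hne : u ≠ u') {x : Pt}
    (hx : x ∈ polyImage [Q, M u, D.p u]) (hx' : x ∈ polyImage [Q, M u', D.p u']) :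
    x = Q := by
  rcases hA.edge_cases hu hx with ⟨h, -⟩ | h | rfl
  · rcases hA.edge_cases hu' hx' with ⟨h', -⟩ | h' | rfl
    · exact eq_of_mem_segments_of_angle (hA.fork u u' hu hu' hne) h h'
    · exact absurd h' (hA.edge_off_zRay hD hv hu ⟨v, hv, hu'.symm⟩ hne.symm hx)
    · exact absurd (hA.edge_inter_image hD hv hu hx (p_mem_drawingImage D u'))
        (fun e => hne (D.p_inj e).symm)
  · exact absurd h (hA.edge_off_zRay hD hv hu' ⟨v, hv, hu.symm⟩ hne hx')
  · exact absurd (hA.edge_inter_image hD hv hu' hx' (p_mem_drawingImage D u))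
        (fun e => hne (D.p_inj e))

lemma simplePolyline (hA : IsHighApex D v Q M H) {u : S} (hu : G.Adj v u) :
    SimplePolyline [Q, M u, D.p u] ∧ SimplePolyline [D.p u, M u, Q] := by
  have h1 : Q ≠ M u := fun h => (hA.bend_lt_apex hu).ne (by rw [← h])
  have h2 : M u ≠ D.p u := fun h => by
    have := (mem_zRay_iff.1 (hA.bend_mem_zRay u hu)).2.2
    exact this.ne (by rw [← h])
  have h3 : ∀ x ∈ segment ℝ Q (M u), x ∈ segment ℝ (M u) (D.p u) → x = M u := by
    intro x hx hx'
    obtain ⟨e0, e1, -, e2⟩ := hA.lower_segment hu hx'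
    obtain ⟨m0, m1, m2⟩ := mem_zRay_iff.1 (hA.bend_mem_zRay u hu)
    exact pt_ext (e0.trans m0.symm) (e1.trans m1.symm)
      (e2.antisymm (hA.upper_segment hu hx).1)
  refine ⟨simplePolyline_triple h1 h2 h3, simplePolyline_triple h2.symm h1.symm ?_⟩
  intro x hx hx'
  rw [segment_symm] at hx hx'
  exact h3 x hx' hx

lemma nonCrossing (hA : IsHighApex D v Q M H) (hD : IsVertExtensible G S D) (hv : v ∉ S) :
    NonCrossing (D.addApex v Q M hA.notMem_range) := by
  have hQ : Q ∉ drawingImage D := fun h => (hA.below Q h).not_gt hA.apex_high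
  apply nonCrossing_of_inter_subset
  · intro x y h
    rcases addApex_edge_cases hv x y h with
      ⟨a, b, h', -, -, e⟩ | ⟨a, ha, -, -, e⟩ | ⟨a, ha, -, -, e⟩ <;> rw [e]
    · exact hD.noncross.1 a b h'
    · exact (hA.simplePolyline ha).1
    · exact (hA.simplePolyline ha).2
  · have hold : ∀ a b h', polyImage (D.seq a b h') ∩
        Set.range (D.addApex v Q M hA.notMem_range).p = {D.p a, D.p b} := by
      intro a b h'
      rw [← hD.noncross.2.1 a b h']
      ext z
      constructor
      · rintro ⟨hz, w, rfl⟩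
        refine ⟨hz, ?_⟩
        rcases eq_newVertex_or_oldVertex v w with rfl | ⟨c, rfl⟩
        · rw [addApex_p_new hv] at hz
          exact absurd (polyImage_subset_drawingImage D h' hz) hQ
        · exact ⟨c, (addApex_p_old c).symm⟩
      · rintro ⟨hz, w, rfl⟩
        exact ⟨hz, oldVertex v w, addApex_p_old w⟩
    have hnew : ∀ a : S, G.Adj v a → polyImage [Q, M a, D.p a] ∩
        Set.range (D.addApex v Q M hA.notMem_range).p = {Q, D.p a} := by
      intro a ha
      ext z
      constructor
      · rintro ⟨hz, w, rfl⟩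
        rcases eq_newVertex_or_oldVertex v w with rfl | ⟨c, rfl⟩
        · exact Or.inl (addApex_p_new hv)
        · rw [addApex_p_old] at hz ⊢
          exact Or.inr (hA.edge_inter_image hD hv ha hz (p_mem_drawingImage D c))
      · rintro (rfl | rfl)
        · refine ⟨?_, newVertex v S, addApex_p_new hv⟩
          rw [polyImage_triple]
          exact Or.inl (left_mem_segment ℝ _ _)
        · refine ⟨?_, oldVertex v a, addApex_p_old a⟩
          rw [polyImage_triple]
          exact Or.inr (right_mem_segment ℝ _ _)
    intro x y h
    rcases addApex_edge_cases hv x y h with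
      ⟨a, b, h', rfl, rfl, e⟩ | ⟨a, ha, rfl, rfl, e⟩ | ⟨a, ha, rfl, rfl, e⟩ <;> rw [e]
    · rw [hold, addApex_p_old, addApex_p_old]
    · rw [hnew a ha, addApex_p_old, addApex_p_new hv]
    · rw [polyImage_triple_symm, hnew a ha, addApex_p_old, addApex_p_new hv, Set.pair_comm]
  · intro x y x' y' h h' hne z ⟨hz, hz'⟩
    have hp : ∀ a : S, D.p a ∈ Set.range (D.addApex v Q M hA.notMem_range).p :=
      fun a => ⟨oldVertex v a, addApex_p_old a⟩
    rcases addApex_edge_image hv x y h with ⟨a, b, k, es, e⟩ | ⟨a, ha, es, e⟩ <;>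
      rcases addApex_edge_image hv x' y' h' with ⟨a', b', k', es', e'⟩ | ⟨a', ha', es', e'⟩ <;>
      rw [e] at hz <;> rw [e'] at hz' <;> rw [es, es'] at hne
    · have hne' : s(a, b) ≠ s(a', b') := fun hs => hne <| by
        simpa using congrArg (Sym2.map (oldVertex v)) hs
      have hz'' := (hD.noncross.2.2 a b a' b' k k' hne').subset ⟨hz, hz'⟩
      obtain ⟨w, -, rfl⟩ := hz''
      exact hp w
    · rw [hA.edge_inter_image hD hv ha' hz' (polyImage_subset_drawingImage D k hz)]
      exact hp a'
    · rw [hA.edge_inter_image hD hv ha hz (polyImage_subset_drawingImage D k' hz')]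
      exact hp a
    · have hne' : a ≠ a' := fun hs => hne (by rw [hs])
      rw [hA.edge_inter_edge hD hv ha ha' hne' hz hz']
      exact ⟨newVertex v S, addApex_p_new hv⟩

lemma angularRes (hA : IsHighApex D v Q M H) (hD : IsVertExtensible G S D) (hv : v ∉ S) :
    AngularResAtLeast (D.addApex v Q M hA.notMem_range) (2 * Real.pi / 3) := by
  have hbend : ∀ u : S, G.Adj v u → 2 * Real.pi / 3 ≤ angle (Q - M u) (D.p u - M u) := by
    intro u hu
    obtain ⟨t, ht, e⟩ := hA.bend_mem_zRay u hu
    rw [angle_bend Q (M u) (D.p u) ht e]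
    exact hA.slope u hu
  have hjoin : ∀ x y : S, G.Adj v x → ∀ h : (G.induce S).Adj x y, ∀ b,
      (D.seq x y h)[1]? = some b → 2 * Real.pi / 3 ≤ angle (M x - D.p x) (b - D.p x) := by
    intro x y hx h b hb
    obtain ⟨t, ht, e⟩ := hA.bend_mem_zRay x hx
    rw [e, add_sub_cancel_left, angle_smul_left_of_pos _ _ ht]
    exact hD.ray_angle x ⟨v, hv, hx.symm⟩ y h b hb
  constructor
  · intro x y h a q b hinf
    rcases addApex_edge_cases hv x y h with
      ⟨c, d, h', -, -, e⟩ | ⟨c, hc, -, -, e⟩ | ⟨c, hc, -, -, e⟩ <;> rw [e] at hinf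
    · exact hD.res.1 c d h' a q b hinf
    · have := hinf.eq_of_length rfl
      simp only [List.cons.injEq, and_true] at this
      obtain ⟨rfl, rfl, rfl⟩ := this
      exact hbend c hc
    · have := hinf.eq_of_length rfl
      simp only [List.cons.injEq, and_true] at this
      obtain ⟨rfl, rfl, rfl⟩ := this
      rw [angle_comm]
      exact hbend c hc
  · intro w x y hx hy hxy a b ha hb
    rcases eq_newVertex_or_oldVertex v w with rfl | ⟨w, rfl⟩ <;>
      rcases eq_newVertex_or_oldVertex v x with rfl | ⟨x, rfl⟩ <;>
      rcases eq_newVertex_or_oldVertex v y with rfl | ⟨y, rfl⟩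
    · exact absurd rfl hxy
    · exact absurd rfl hx.ne
    · exact absurd rfl hy.ne
    · rw [addApex_seq_new_old hv] at ha hb
      rw [addApex_p_new hv]
      simp only [List.getElem?_cons_succ, List.getElem?_cons_zero, Option.some.injEq] at ha hb
      subst ha hb
      exact hA.fork x y hx hy fun h => hxy (by rw [h])
    · exact absurd rfl hxy
    · rw [addApex_seq_old_new hv] at ha
      rw [addApex_seq_old] at hb
      rw [addApex_p_old]
      simp only [List.getElem?_cons_succ, List.getElem?_cons_zero, Option.some.injEq] at ha
      subst ha
      exact hjoin w y (G.adj_symm hx) hy b hb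
    · rw [addApex_seq_old_new hv] at hb
      rw [addApex_seq_old] at ha
      rw [addApex_p_old, angle_comm]
      simp only [List.getElem?_cons_succ, List.getElem?_cons_zero, Option.some.injEq] at hb
      subst hb
      exact hjoin w x (G.adj_symm hy) hx a ha
    · rw [addApex_seq_old] at ha hb
      rw [addApex_p_old]
      exact hD.res.2 w x y hx hy (fun h => hxy (by rw [h])) a b ha hb

lemma isVertExtensible (hA : IsHighApex D v Q M H) (hD : IsVertExtensible G S D) (hv : v ∉ S)
    (hout : ∀ w w', w ∉ S → w' ∉ S → G.Adj v w → G.Adj v w' → w = w') :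
    IsVertExtensible G (insert v S) (D.addApex v Q M hA.notMem_range) := by
  have hray : ∀ x : S, (∃ w, w ∉ insert v S ∧ G.Adj (oldVertex v x : V) w) →
      HasRay G S x ∧ ¬ G.Adj v x := by
    rintro x ⟨w, hw, hxw⟩
    have hwS : w ∉ S := fun h => hw (Or.inr h)
    exact ⟨⟨w, hwS, hxw⟩, fun hvx =>
      hw (Or.inl (hD.out_unique x w v hwS hv hxw hvx.symm))⟩
  refine ⟨hA.nonCrossing hD hv, ?_, hA.angularRes hD hv, ?_, ?_, ?_, ?_⟩
  · intro x y h
    rcases addApex_edge_cases hv x y h with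
      ⟨a, b, h', -, -, e⟩ | ⟨a, ha, -, -, e⟩ | ⟨a, ha, -, -, e⟩ <;> rw [e]
    · exact hD.bends a b h'
    · simp
    · simp
  · intro x w w' hw hw' hxw hxw'
    have hwS : w ∉ S := fun h => hw (Or.inr h)
    have hwS' : w' ∉ S := fun h => hw' (Or.inr h)
    rcases eq_newVertex_or_oldVertex v x with rfl | ⟨x, rfl⟩
    · exact hout w w' hwS hwS' hxw hxw'
    · exact hD.out_unique x w w' hwS hwS' hxw hxw'
  · intro x hx
    rw [Set.eq_empty_iff_forall_notMem]
    rintro z ⟨hz, hz'⟩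
    rcases eq_newVertex_or_oldVertex v x with rfl | ⟨x, rfl⟩
    · rw [addApex_p_new hv] at hz
      have hzQ := (mem_zRay_iff.1 hz).2.2
      rcases addApex_drawingImage hv hz' with h | rfl | ⟨a, ha, h⟩
      · linarith [hA.below z h, hA.apex_high]
      · exact lt_irrefl _ hzQ
      · rw [polyImage_triple] at h
        rcases h with h | h
        · linarith [(hA.upper_segment ha h).2]
        · linarith [(hA.lower_segment ha h).2.2.2, hA.bend_lt_apex ha]
    · rw [addApex_p_old] at hz
      obtain ⟨hr, hvx⟩ := hray x hx
      rcases addApex_drawingImage hv hz' with h | rfl | ⟨a, ha, h⟩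
      · exact hD.notMem_zRay hr h hz
      · exact hA.apex_off_rays x hr hvx hz
      · exact hA.edge_off_zRay hD hv ha hr (fun e => hvx (e ▸ ha)) h hz
  · intro x hx y h a ha
    rcases eq_newVertex_or_oldVertex v x with rfl | ⟨x, rfl⟩ <;>
      rcases eq_newVertex_or_oldVertex v y with rfl | ⟨y, rfl⟩
    · exact absurd rfl h.ne
    · rw [addApex_seq_new_old hv] at ha
      rw [addApex_p_new hv]
      simp only [List.getElem?_cons_succ, List.getElem?_cons_zero, Option.some.injEq] at ha
      subst ha
      exact hA.slope y h
    · exact absurd (G.adj_symm h) (hray x hx).2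
    · rw [addApex_seq_old] at ha
      rw [addApex_p_old]
      exact hD.ray_angle x (hray x hx).1 y h a ha
  · intro x y z hx hy hz hxy hxz hyz hc
    have hdet := planarDet_eq_zero_of_coplanar_zRays hc
    rcases eq_newVertex_or_oldVertex v x with rfl | ⟨x, rfl⟩ <;>
      rcases eq_newVertex_or_oldVertex v y with rfl | ⟨y, rfl⟩ <;>
      rcases eq_newVertex_or_oldVertex v z with rfl | ⟨z, rfl⟩ <;>
      first
      | exact hxy rfl
      | exact hxz rfl
      | exact hyz rfl
      | simp only [addApex_p_new hv, addApex_p_old] at hdet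
    · exact hA.generic y z (hray y hy).1 (hray z hz).1 (hray y hy).2 (hray z hz).2
        (fun h => hyz (by rw [h])) hdet
    · refine hA.generic x z (hray x hx).1 (hray z hz).1 (hray x hx).2 (hray z hz).2
        (fun h => hxz (by rw [h])) ?_
      unfold planarDet at hdet ⊢
      linear_combination -hdet
    · refine hA.generic x y (hray x hx).1 (hray y hy).1 (hray x hx).2 (hray y hy).2
        (fun h => hxy (by rw [h])) ?_
      unfold planarDet at hdet ⊢
      linear_combination hdet
    · exact hD.planarDet_ne_zero (hray x hx).1 (hray y hy).1 (hray z hz).1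
        (fun h => hxy (by rw [h])) (fun h => hxz (by rw [h])) (fun h => hyz (by rw [h])) hdet

end IsHighApex

end Extension

section Placement

variable {S : Set V} {D : PolylineDrawing (G.induce S)} {v : V}

lemma exists_isHighApex_of_no_neighbor [Finite V] (hN : ∀ u : S, ¬ G.Adj v u)
    (hD : IsVertExtensible G S D) : ∃ Q M H, IsHighApex D v Q M H := by
  obtain ⟨H, hH⟩ := exists_height_bound D
  obtain ⟨r, hr⟩ := (Set.finite_range fun x : S => D.p x 0).exists_notMem
  have hr' : ∀ x, D.p x 0 ≠ r := fun x hx => hr ⟨x, hx⟩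
  have hfin : (⋃ (x : S) (y : S), {s : ℝ | D.p x 0 ≠ D.p y 0 ∧
      (D.p x 0 - r) * (D.p y 1 - s) - (D.p x 1 - s) * (D.p y 0 - r) = 0}).Finite := by
    refine Set.finite_iUnion fun x => Set.finite_iUnion fun y => Set.Subsingleton.finite ?_
    rintro s ⟨hne, hs⟩ s' ⟨-, hs'⟩
    have : (D.p y 0 - D.p x 0) * (s - s') = 0 := by linear_combination hs - hs'
    exact sub_eq_zero.1 ((mul_eq_zero.1 this).resolve_left (sub_ne_zero.2 hne.symm))
  obtain ⟨s, hs⟩ := hfin.exists_notMem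
  simp only [Set.mem_iUnion, Set.mem_ofPred_eq, not_exists, not_and] at hs
  refine ⟨!₂[r, s, H + 1], fun _ => 0, H, hH, by simp, fun u hu => absurd hu (hN u),
    fun u hu => absurd hu (hN u), fun u hu => absurd hu (hN u), fun u _ hu => absurd hu (hN u),
    fun u hu => absurd hu (hN u), ?_, ?_⟩
  · intro x _ _ hq
    exact hr' x (by simpa using (mem_zRay_iff.1 hq).1.symm)
  · intro x y hx hy _ _ hxy hdet
    simp only [planarDet, Matrix.cons_val_zero, Matrix.cons_val_one] at hdet
    by_cases h : D.p x 0 = D.p y 0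
    · have hprod : (D.p y 0 - r) * (D.p y 1 - D.p x 1) = 0 := by
        rw [h] at hdet
        linear_combination hdet
      have h1 := (mul_eq_zero.1 hprod).resolve_left (sub_ne_zero.2 (hr' y))
      exact hxy (hD.eq_of_horizontal_eq hx hy h (sub_eq_zero.1 h1).symm)
    · exact hs x y h hdet

lemma exists_isHighApex_of_one_neighbor [Finite V] (hv : v ∉ S) {a : S}
    (hN : ∀ u : S, G.Adj v u ↔ u = a) (hD : IsVertExtensible G S D) :
    ∃ Q M H, IsHighApex D v Q M H := by
  obtain ⟨H, hH⟩ := exists_height_bound D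
  have hra : HasRay G S a := ⟨v, hv, ((hN a).2 rfl).symm⟩
  have ha := hH _ (p_mem_drawingImage D a)
  refine ⟨!₂[D.p a 0, D.p a 1, H + 2], fun _ => !₂[D.p a 0, D.p a 1, H + 1], H, hH, by simp,
    by simp, ?_, ?_, ?_, ?_, ?_, ?_⟩
  · rintro u hu
    obtain rfl := (hN u).1 hu
    rw [mem_zRay_iff]
    simp
    linarith
  · intro u _
    exact two_pi_div_three_le_angle one_pos one_pos (by simp) (by simp; norm_num)
      (by simp; norm_num)
  · intro u u' hu hu' hne
    exact absurd (((hN u).1 hu).trans ((hN u').1 hu').symm) hne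
  · intro u hu x hx hxu q hq hqx
    obtain rfl := (hN u).1 hu
    obtain ⟨t, -, -, ht⟩ := mem_segment_coords hq
    obtain ⟨h0, h1, -⟩ := mem_zRay_iff.1 hqx
    rw [ht] at h0 h1
    exact hxu (hD.eq_of_horizontal_eq hx hra (by simpa using h0.symm) (by simpa using h1.symm))
  · intro x hx hvx hq
    obtain ⟨h0, h1, -⟩ := mem_zRay_iff.1 hq
    exact hvx ((hN x).2 (hD.eq_of_horizontal_eq hx hra (by simpa using h0.symm)
      (by simpa using h1.symm)))
  · intro x y hx hy hvx hvy hxy hdet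
    exact hD.planarDet_ne_zero hra hx hy (fun h => hvx ((hN x).2 h.symm))
      (fun h => hvy ((hN y).2 h.symm)) hxy (by simpa [planarDet] using hdet)

lemma exists_isHighApex_of_two_neighbors [Finite V] (hv : v ∉ S) {a b : S} (hab : a ≠ b)
    (hN : ∀ u : S, G.Adj v u ↔ u = a ∨ u = b) (hD : IsVertExtensible G S D) :
    ∃ Q M H, IsHighApex D v Q M H := by
  classical
  obtain ⟨H, hH⟩ := exists_height_bound D
  have hra : HasRay G S a := ⟨v, hv, ((hN a).2 (Or.inl rfl)).symm⟩
  have hrb : HasRay G S b := ⟨v, hv, ((hN b).2 (Or.inr rfl)).symm⟩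
  have ha := hH _ (p_mem_drawingImage D a)
  have hb := hH _ (p_mem_drawingImage D b)
  have hfin : (⋃ (x : S) (y : S), {s : ℝ | planarDet (D.p a) (D.p x) (D.p y) ≠ 0 ∧
      (1 - s) * planarDet (D.p a) (D.p x) (D.p y) +
        s * planarDet (D.p b) (D.p x) (D.p y) = 0}).Finite := by
    refine Set.finite_iUnion fun x => Set.finite_iUnion fun y => Set.Subsingleton.finite ?_
    rintro s ⟨hne, hs⟩ s' ⟨-, hs'⟩
    have : planarDet (D.p a) (D.p x) (D.p y) * (s - s') = 0 := by
      linear_combination s * hs' - s' * hs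
    exact sub_eq_zero.1 ((mul_eq_zero.1 this).resolve_left hne)
  obtain ⟨s, ⟨hs0, hs1⟩, hs⟩ := (Set.Ioo_infinite (zero_lt_one' ℝ)).exists_notMem_finite hfin
  simp only [Set.mem_iUnion, Set.mem_ofPred_eq, not_exists, not_and] at hs
  set A := D.p a with hA
  set B := D.p b with hB
  obtain ⟨w0, hw0⟩ : ∃ w, w = B 0 - A 0 := ⟨_, rfl⟩
  obtain ⟨w1, hw1⟩ : ∃ w, w = B 1 - A 1 := ⟨_, rfl⟩
  have hw : ∀ c : ℝ, c * w0 = 0 → c * w1 = 0 → c = 0 := by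
    intro c h0 h1
    by_contra hc
    refine hab (hD.eq_of_horizontal_eq hra hrb ?_ ?_)
    · linarith [(mul_eq_zero.1 h0).resolve_left hc]
    · linarith [(mul_eq_zero.1 h1).resolve_left hc]
  have hline : ∀ x, HasRay G S x → x ≠ a → x ≠ b → ∀ c : ℝ,
      ¬ (D.p x 0 = A 0 + c * w0 ∧ D.p x 1 = A 1 + c * w1) := by
    rintro x hx hxa hxb c ⟨h0, h1⟩
    refine hD.planarDet_ne_zero hra hrb hx hab hxa.symm hxb.symm ?_
    rw [planarDet, h0, h1, ← hA, ← hB, ← hw0, ← hw1]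
    ring
  obtain ⟨L, hL, hL2⟩ : ∃ L : ℝ, 0 < L ∧ w0 ^ 2 + w1 ^ 2 = 3 * L ^ 2 := by
    have hpos : 0 < w0 ^ 2 + w1 ^ 2 := by
      by_contra! hle
      have h0 : w0 = 0 := by nlinarith [sq_nonneg w0, sq_nonneg w1]
      have h1 : w1 = 0 := by nlinarith [sq_nonneg w0, sq_nonneg w1]
      exact one_ne_zero (hw 1 (by simp [h0]) (by simp [h1]))
    refine ⟨√((w0 ^ 2 + w1 ^ 2) / 3), by positivity, ?_⟩
    rw [Real.sq_sqrt (by positivity)]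
    ring
  have hs' : 0 < 1 - s := by linarith
  have hsL : 0 < s * L := by positivity
  have hsL' : 0 < (1 - s) * L := by positivity
  obtain ⟨Q, hQ⟩ : ∃ Q : Pt, Q = !₂[A 0 + s * w0, A 1 + s * w1, H + L + 1] := ⟨_, rfl⟩
  obtain ⟨Ma, hMa⟩ : ∃ P : Pt, P = !₂[A 0, A 1, H + L + 1 - s * L] := ⟨_, rfl⟩
  obtain ⟨Mb, hMb⟩ : ∃ P : Pt, P = !₂[A 0 + w0, A 1 + w1, H + L + 1 - (1 - s) * L] := ⟨_, rfl⟩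
  have hra' : 0 < 2 * (s * L) := by positivity
  have hrb' : 0 < 2 * ((1 - s) * L) := by positivity
  have na : (Ma - Q) 0 ^ 2 + (Ma - Q) 1 ^ 2 + (Ma - Q) 2 ^ 2 = (2 * (s * L)) ^ 2 := by
    simp [hMa, hQ]
    linear_combination s ^ 2 * hL2
  have nb : (Mb - Q) 0 ^ 2 + (Mb - Q) 1 ^ 2 + (Mb - Q) 2 ^ 2 = (2 * ((1 - s) * L)) ^ 2 := by
    simp [hMb, hQ]
    linear_combination (1 - s) ^ 2 * hL2
  have hfork : 2 * Real.pi / 3 ≤ angle (Ma - Q) (Mb - Q) := by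
    refine two_pi_div_three_le_angle hra' hrb' na nb (le_of_eq ?_)
    simp [hMa, hMb, hQ]
    linear_combination (-2 * s * (1 - s)) * hL2
  have hM : ∀ u : S, G.Adj v u → (u = a ∧ (if u = a then Ma else Mb) = Ma) ∨
      (u = b ∧ (if u = a then Ma else Mb) = Mb) := by
    intro u hu
    rcases (hN u).1 hu with rfl | rfl
    · exact Or.inl ⟨rfl, if_pos rfl⟩
    · exact Or.inr ⟨rfl, if_neg hab.symm⟩
  refine ⟨Q, fun u => if u = a then Ma else Mb, H, hH, by simp [hQ]; linarith, ?_, ?_, ?_, ?_,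
    ?_, ?_, ?_⟩
  · intro u hu
    rcases hM u hu with ⟨-, e⟩ | ⟨-, e⟩ <;> simp only [e]
    · simp [hMa]
      linarith
    · simp [hMb]
      linarith
  · intro u hu
    rcases hM u hu with ⟨rfl, e⟩ | ⟨rfl, e⟩ <;> simp only [e] <;> rw [mem_zRay_iff]
    · refine ⟨by simp [hMa, hA], by simp [hMa, hA], ?_⟩
      simp [hMa]
      linarith
    · refine ⟨by simp [hMb, hw0, hB], by simp [hMb, hw1, hB], ?_⟩
      simp [hMb]
      linarith
  · intro u hu
    rcases hM u hu with ⟨-, e⟩ | ⟨-, e⟩ <;> simp only [e]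
    · refine two_pi_div_three_le_angle one_pos hra' (by simp) na (le_of_eq ?_)
      simp [hMa, hQ]
    · refine two_pi_div_three_le_angle one_pos hrb' (by simp) nb (le_of_eq ?_)
      simp [hMb, hQ]
  · intro u u' hu hu' hne
    rcases hM u hu with ⟨rfl, e⟩ | ⟨rfl, e⟩ <;>
      rcases hM u' hu' with ⟨rfl, e'⟩ | ⟨rfl, e'⟩ <;> simp only [e, e']
    · exact absurd rfl hne
    · exact hfork
    · rw [angle_comm]
      exact hfork
    · exact absurd rfl hne
  · intro u hu x hx hxu q hq hqx
    obtain ⟨h0, h1, -⟩ := mem_zRay_iff.1 hqx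
    rcases hM u hu with ⟨rfl, e⟩ | ⟨rfl, e⟩ <;> simp only [e] at hq <;>
      obtain ⟨t, ht0, ht1, ht⟩ := mem_segment_coords hq <;> rw [ht] at h0 h1
    · simp [hQ, hMa] at h0 h1
      by_cases hxb : x = b
      · subst hxb
        have := hw (1 - s * (1 - t)) (by linear_combination -h0 + hw0)
          (by linear_combination -h1 + hw1)
        linarith [mul_nonneg hs0.le ht0]
      · exact hline x hx hxu hxb (s * (1 - t))
          ⟨by linear_combination -h0, by linear_combination -h1⟩
    · simp [hQ, hMb] at h0 h1
      by_cases hxa : x = a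
      · subst hxa
        have := hw (s + t * (1 - s)) (by linear_combination h0) (by linear_combination h1)
        linarith [mul_nonneg ht0 hs'.le]
      · exact hline x hx hxa hxu (s + t * (1 - s))
          ⟨by linear_combination -h0, by linear_combination -h1⟩
  · intro x hx hvx hq
    obtain ⟨h0, h1, -⟩ := mem_zRay_iff.1 hq
    rw [hN, not_or] at hvx
    exact hline x hx hvx.1 hvx.2 s ⟨by simpa [hQ] using h0.symm, by simpa [hQ] using h1.symm⟩
  · intro x y hx hy hvx hvy hxy hdet
    rw [hN, not_or] at hvx hvy
    refine hs x y (hD.planarDet_ne_zero hra hx hy (Ne.symm hvx.1) (Ne.symm hvy.1) hxy) ?_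
    rw [← hdet]
    simp [planarDet, hQ, hw0, hw1]
    ring

lemma exists_isHighApex [Finite V] (hv : v ∉ S)
    (hin : ({w : V | G.Adj v w} ∩ S).ncard ≤ 2) (hD : IsVertExtensible G S D) :
    ∃ Q M H, IsHighApex D v Q M H := by
  have hmem : ∀ u : S, G.Adj v u ↔ (u : V) ∈ {w : V | G.Adj v w} ∩ S :=
    fun u => ⟨fun h => ⟨h, u.2⟩, fun h => h.1⟩
  obtain h | h | h : ({w : V | G.Adj v w} ∩ S).ncard = 0 ∨
      ({w : V | G.Adj v w} ∩ S).ncard = 1 ∨ ({w : V | G.Adj v w} ∩ S).ncard = 2 := by omega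
  · rw [Set.ncard_eq_zero] at h
    exact exists_isHighApex_of_no_neighbor (fun u hu => by simpa [h] using (hmem u).1 hu) hD
  · obtain ⟨a, h⟩ := Set.ncard_eq_one.1 h
    have ha : a ∈ S := (h.symm.subset rfl).2
    refine exists_isHighApex_of_one_neighbor hv (a := ⟨a, ha⟩) (fun u => ?_) hD
    rw [hmem, h, Set.mem_singleton_iff, Subtype.ext_iff]
  · obtain ⟨a, b, hab, h⟩ := Set.ncard_eq_two.1 h
    have ha : a ∈ S := (h.symm.subset (Or.inl rfl)).2
    have hb : b ∈ S := (h.symm.subset (Or.inr rfl)).2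
    refine exists_isHighApex_of_two_neighbors hv (a := ⟨a, ha⟩) (b := ⟨b, hb⟩)
      (fun e => hab (congrArg Subtype.val e)) (fun u => ?_) hD
    rw [hmem, h, Set.mem_insert_iff, Set.mem_singleton_iff, Subtype.ext_iff, Subtype.ext_iff]

end Placement

/-- If a vertex set `S` of a graph `G` of maximum degree at most three
admits a vertically extensible partial drawing, and `v ∉ S` has at most two neighbors
in `S` and at most one neighbor outside `S`, then `S ∪ {v}` admits a vertically
extensible partial drawing. -/
theorem add_vertex_to_extensible (V : Type) [Fintype V] [DecidableEq V]
    (G : SimpleGraph V) [DecidableRel G.Adj]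
    (hdeg : ∀ v, G.degree v ≤ 3) (S : Set V)
    (hS : ∃ D : PolylineDrawing (G.induce S), IsVertExtensible G S D)
    (v : V) (hv : v ∉ S)
    (hin : ({w : V | G.Adj v w} ∩ S).ncard ≤ 2)
    (hout : ({w : V | G.Adj v w} \ S).ncard ≤ 1) :
    ∃ D : PolylineDrawing (G.induce (insert v S)),
      IsVertExtensible G (insert v S) D := by
  obtain ⟨D, hD⟩ := hS
  obtain ⟨Q, M, H, hA⟩ := exists_isHighApex hv hin hD
  refine ⟨_, hA.isVertExtensible hD hv fun w w' hw hw' hvw hvw' => ?_⟩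
  exact (Set.ncard_le_one (Set.toFinite _)).1 hout w ⟨hvw, hw⟩ w' ⟨hvw', hw'⟩
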